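/- arXiv:1708.01663 — 3 statements merged into one kernel-verified Lean document; each statement's English description precedes it below -/
import Mathlib

section
/- Let D : ℝ^N → ℝ be differentiable with ‖∇D(x) − ∇D(y)‖ ≤ L‖x − y‖ for all x, y ∈ ℝ^N, let R : ℝ^N → ℝ ∪ {+∞} be proper, convex and lower semicontinuous, and let γ > 0 be such that prox_{γR}(x) exists and is unique for every x; define G_γ(x) = (x − prox_{γR}(x − γ∇D(x)))/γ. If s ∈ ℝ^N and f = prox_{γR}(s − γ∇D(s)), then ‖G_γ(f)‖ ≤ (3 + γL)·‖G_γ(s)‖. -/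
open scoped RealInnerProductSpace

/-- The gradient mapping `G_γ(x) = (x - prox_{γR}(x - γ∇D(x)))/γ`. -/
noncomputable def gradMap {N : ℕ} (γ : ℝ)
    (gradD : EuclideanSpace ℝ (Fin N) → EuclideanSpace ℝ (Fin N))
    (prox : EuclideanSpace ℝ (Fin N) → EuclideanSpace ℝ (Fin N))
    (x : EuclideanSpace ℝ (Fin N)) : EuclideanSpace ℝ (Fin N) :=
  γ⁻¹ • (x - prox (x - γ • gradD x))

/-- First-order optimality inequality, up to a quadratic error, for a finite minimizer `p` of
`z ↦ R z + c‖z - x‖²` compared with a point `q` where `R` is finite. -/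
lemma le_of_isMinimizer_add_sq {E : Type*} [NormedAddCommGroup E] [InnerProductSpace ℝ E]
    {R : E → EReal}
    (hR : ∀ x y : E, ∀ a b : ℝ, 0 ≤ a → 0 ≤ b → a + b = 1 →
      R (a • x + b • y) ≤ (a : EReal) * R x + (b : EReal) * R y)
    {c : ℝ} {x p q : E} {u v : ℝ} (hu : R p = u) (hv : R q = v)
    (hp : ∀ z, R p + ((c * ‖p - x‖ ^ 2 : ℝ) : EReal) ≤ R z + ((c * ‖z - x‖ ^ 2 : ℝ) : EReal))
    {t : ℝ} (ht : 0 < t) (ht1 : t < 1) :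
    u ≤ v + 2 * c * ⟪q - p, p - x⟫ + c * t * ‖q - p‖ ^ 2 := by
  have h1 := (hp ((1 - t) • p + t • q)).trans
    (add_le_add_left (hR p q (1 - t) t (by linarith) ht.le (by ring)) _)
  rw [hu, hv] at h1
  norm_cast at h1
  have h2 : (1 - t) • p + t • q - x = (p - x) + t • (q - p) := by module
  rw [h2, norm_add_sq_real, inner_smul_right, norm_smul, mul_pow, Real.norm_eq_abs, sq_abs,
    real_inner_comm] at h1
  refine le_of_mul_le_mul_left ?_ ht
  linarith

/-- A minimizer of `z ↦ R z + c‖z - x‖²` has finite value when `R` is proper. -/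
lemma exists_coe_eq_of_isMinimizer {E : Type*} [NormedAddCommGroup E] {R : E → EReal}
    (hproper : ∃ x, R x ≠ ⊤) (hbot : ∀ x, R x ≠ ⊥) {c : ℝ} {x p : E}
    (hp : ∀ z, R p + ((c * ‖p - x‖ ^ 2 : ℝ) : EReal) ≤ R z + ((c * ‖z - x‖ ^ 2 : ℝ) : EReal)) :
    ∃ u : ℝ, R p = u := by
  obtain ⟨z, hz⟩ := hproper
  have hne : R p ≠ ⊤ := by
    intro h
    have h1 := hp z
    rw [h, EReal.top_add_coe, top_le_iff, ← EReal.coe_toReal hz (hbot z)] at h1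
    exact EReal.coe_ne_top _ (by exact_mod_cast h1)
  exact ⟨_, (EReal.coe_toReal hne (hbot p)).symm⟩

/-- The proximal operator of a proper convex function is nonexpansive. -/
lemma norm_sub_le_of_isMinimizer {E : Type*} [NormedAddCommGroup E] [InnerProductSpace ℝ E]
    {R : E → EReal} (hproper : ∃ x, R x ≠ ⊤) (hbot : ∀ x, R x ≠ ⊥)
    (hR : ∀ x y : E, ∀ a b : ℝ, 0 ≤ a → 0 ≤ b → a + b = 1 →
      R (a • x + b • y) ≤ (a : EReal) * R x + (b : EReal) * R y)
    {c : ℝ} (hc : 0 < c) {x y p q : E}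
    (hp : ∀ z, R p + ((c * ‖p - x‖ ^ 2 : ℝ) : EReal) ≤ R z + ((c * ‖z - x‖ ^ 2 : ℝ) : EReal))
    (hq : ∀ z, R q + ((c * ‖q - y‖ ^ 2 : ℝ) : EReal) ≤ R z + ((c * ‖z - y‖ ^ 2 : ℝ) : EReal)) :
    ‖p - q‖ ≤ ‖x - y‖ := by
  obtain ⟨u, hu⟩ := exists_coe_eq_of_isMinimizer hproper hbot hp
  obtain ⟨v, hv⟩ := exists_coe_eq_of_isMinimizer hproper hbot hq
  have key : ∀ t ∈ Set.Ioo (0 : ℝ) 1, (1 - t) * ‖p - q‖ ^ 2 ≤ ⟪p - q, x - y⟫ := by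
    rintro t ⟨ht, ht1⟩
    have h1 := le_of_isMinimizer_add_sq hR hu hv hp ht ht1
    have h2 := le_of_isMinimizer_add_sq hR hv hu hq ht ht1
    have h3 : ⟪q - p, p - x⟫ + ⟪p - q, q - y⟫ = ⟪p - q, x - y⟫ - ‖p - q‖ ^ 2 := by
      rw [← real_inner_self_eq_norm_sq, ← neg_sub p q, inner_neg_left, neg_add_eq_sub,
        ← inner_sub_right, ← inner_sub_right]
      congr 1
      abel
    rw [norm_sub_rev q p] at h1
    refine le_of_mul_le_mul_left ?_ (mul_pos two_pos hc)
    linear_combination h1 + h2 + 2 * c * h3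
  have hlim : Filter.Tendsto (fun t : ℝ => (1 - t) * ‖p - q‖ ^ 2) (nhdsWithin 0 (Set.Ioi 0))
      (nhds ((1 - 0) * ‖p - q‖ ^ 2)) :=
    (Continuous.tendsto (by fun_prop) 0).mono_left nhdsWithin_le_nhds
  have h := le_of_tendsto hlim
    (Filter.mem_of_superset (Ioo_mem_nhdsGT one_pos) key)
  have h' := h.trans (real_inner_le_norm _ _)
  by_contra! hlt
  nlinarith [norm_nonneg (x - y)]

/-- If `f = prox_{γR}(s - γ∇D(s))`, then `‖G_γ(f)‖ ≤ (3 + γL)‖G_γ(s)‖`. -/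
theorem stmt10 (N : ℕ) (D : EuclideanSpace ℝ (Fin N) → ℝ)
    (gradD : EuclideanSpace ℝ (Fin N) → EuclideanSpace ℝ (Fin N))
    (hdiff : ∀ x, HasGradientAt D (gradD x) x)
    (L : ℝ) (hLip : ∀ x y, ‖gradD x - gradD y‖ ≤ L * ‖x - y‖)
    (R : EuclideanSpace ℝ (Fin N) → EReal)
    (hRproper : ∃ x, R x ≠ ⊤) (hRbot : ∀ x, R x ≠ ⊥)
    (hRconvex : ∀ x y : EuclideanSpace ℝ (Fin N), ∀ a b : ℝ, 0 ≤ a → 0 ≤ b → a + b = 1 →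
      R (a • x + b • y) ≤ (a : EReal) * R x + (b : EReal) * R y)
    (hRlsc : LowerSemicontinuous R)
    (γ : ℝ) (hγ : 0 < γ)
    (prox : EuclideanSpace ℝ (Fin N) → EuclideanSpace ℝ (Fin N))
    -- `prox x` is the unique minimizer of `z ↦ R(z) + (1/(2γ))‖z - x‖²`
    (hprox : ∀ x p, p = prox x ↔
      ∀ z, R p + ((1 / (2 * γ) * ‖p - x‖ ^ 2 : ℝ) : EReal) ≤
        R z + ((1 / (2 * γ) * ‖z - x‖ ^ 2 : ℝ) : EReal))
    (s f : EuclideanSpace ℝ (Fin N)) (hf : f = prox (s - γ • gradD s)) :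
    ‖gradMap γ gradD prox f‖ ≤ (3 + γ * L) * ‖gradMap γ gradD prox s‖ := by
  have hmin := fun x => (hprox x (prox x)).1 rfl
  have hne := norm_sub_le_of_isMinimizer hRproper hRbot hRconvex
    (by positivity : 0 < 1 / (2 * γ)) (hmin (s - γ • gradD s)) (hmin (f - γ • gradD f))
  rw [← hf] at hne
  have hsplit : s - γ • gradD s - (f - γ • gradD f) = (s - f) - γ • (gradD s - gradD f) := by
    module
  have hnorm : ‖s - γ • gradD s - (f - γ • gradD f)‖ ≤ ‖s - f‖ + γ * (L * ‖s - f‖) := by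
    rw [hsplit]
    refine (norm_sub_le _ _).trans ?_
    rw [norm_smul, Real.norm_of_nonneg hγ.le]
    gcongr
    exact hLip s f
  have hmain : ‖f - prox (f - γ • gradD f)‖ ≤ (3 + γ * L) * ‖s - f‖ := by
    linarith [norm_nonneg (s - f)]
  rw [gradMap, gradMap, ← hf, norm_smul, norm_smul, mul_left_comm]
  gcongr
end

section
/- (Per-iteration inequality of relaxed FISTA.) Under the relaxed FISTA setup with step size 0 < γ ≤ (1 − α²)/(2L), for every k ≥ 0: F(f_{k+1}) − F(f_k) ≤ (1/(2γ) − L)·(‖f_k − f_{k−1}‖² − ‖f_{k+1} − f_k‖²) − (1/(2γ) − L/2)·‖s_{k+1} − f_{k+1}‖². -/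
open scoped RealInnerProductSpace

/-- Quadratic lower bound for a function with `L`-Lipschitz gradient. -/
theorem add_inner_gradient_sub_sq_le {E : Type*} [NormedAddCommGroup E] [InnerProductSpace ℝ E]
    [CompleteSpace E] {D : E → ℝ} {gradD : E → E} (hdiff : ∀ x, HasGradientAt D (gradD x) x)
    {L : ℝ} (hLip : ∀ x y, ‖gradD x - gradD y‖ ≤ L * ‖x - y‖) (p x : E) :
    D p + ⟪gradD p, x - p⟫ - L / 2 * ‖x - p‖ ^ 2 ≤ D x := by
  set d := x - p with hd
  have hderiv : ∀ τ : ℝ, HasDerivAt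
      (fun τ : ℝ => D (p + τ • d) - τ * ⟪gradD p, d⟫ + L / 2 * ‖d‖ ^ 2 * τ ^ 2)
      (⟪gradD (p + τ • d), d⟫ - ⟪gradD p, d⟫ + L * ‖d‖ ^ 2 * τ) τ := by
    intro τ
    have hline : HasDerivAt (fun τ : ℝ => p + τ • d) d τ := by
      simpa using ((hasDerivAt_id τ).smul_const d).const_add p
    have hcomp := (hdiff (p + τ • d)).hasFDerivAt.comp_hasDerivAt τ hline
    have hlin := (hasDerivAt_id τ).mul_const ⟪gradD p, d⟫
    have hsq := (hasDerivAt_pow 2 τ).const_mul (L / 2 * ‖d‖ ^ 2)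
    refine ((hcomp.sub hlin).add hsq).congr_deriv ?_
    simp only [InnerProductSpace.toDual_apply_apply]
    norm_num
    ring
  have hmono : MonotoneOn
      (fun τ : ℝ => D (p + τ • d) - τ * ⟪gradD p, d⟫ + L / 2 * ‖d‖ ^ 2 * τ ^ 2)
      (Set.Icc 0 1) := by
    refine monotoneOn_of_deriv_nonneg (convex_Icc 0 1)
      (fun τ _ => (hderiv τ).continuousAt.continuousWithinAt)
      (fun τ _ => (hderiv τ).differentiableAt.differentiableWithinAt) fun τ hτ => ?_
    rw [interior_Icc] at hτ
    rw [(hderiv τ).deriv, ← inner_sub_left]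
    have hnorm : ‖gradD (p + τ • d) - gradD p‖ ≤ L * (τ * ‖d‖) := by
      simpa [norm_smul, abs_of_pos hτ.1] using hLip (p + τ • d) p
    have habs := neg_le_of_abs_le (abs_real_inner_le_norm (gradD (p + τ • d) - gradD p) d)
    nlinarith [mul_le_mul_of_nonneg_right hnorm (norm_nonneg d)]
  have h01 := hmono (Set.left_mem_Icc.2 zero_le_one) (Set.right_mem_Icc.2 zero_le_one) zero_le_one
  simp [hd] at h01
  linarith

theorem le_of_forall_mem_Ioo_le_add_mul {a b c : ℝ}
    (h : ∀ l ∈ Set.Ioo (0 : ℝ) 1, a ≤ b + l * c) : a ≤ b := by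
  have hcont : ContinuousWithinAt (fun l : ℝ => b + l * c) (Set.Ioi 0) 0 := by fun_prop
  have hlim : Filter.Tendsto (fun l : ℝ => b + l * c) (nhdsWithin 0 (Set.Ioi 0)) (nhds b) := by
    simpa [ContinuousWithinAt] using hcont
  exact ge_of_tendsto hlim (Filter.mem_of_superset (Ioo_mem_nhdsGT zero_lt_one) h)

/-- Variational inequality for a minimizer `p` of `z ↦ R z + c * ‖z - v‖ ^ 2`, `R` convex. -/
theorem toReal_sub_toReal_le_of_isMinimizer {E : Type*} [NormedAddCommGroup E]
    [InnerProductSpace ℝ E] {R : E → EReal} (hRbot : ∀ x, R x ≠ ⊥)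
    (hRconvex : ∀ x y : E, ∀ a b : ℝ, 0 ≤ a → 0 ≤ b → a + b = 1 →
      R (a • x + b • y) ≤ (a : EReal) * R x + (b : EReal) * R y)
    {c : ℝ} {v p x : E} (hp : R p ≠ ⊤) (hx : R x ≠ ⊤)
    (hmin : ∀ z, R p + ((c * ‖p - v‖ ^ 2 : ℝ) : EReal) ≤ R z + ((c * ‖z - v‖ ^ 2 : ℝ) : EReal)) :
    (R p).toReal - (R x).toReal ≤ 2 * c * ⟪p - v, x - p⟫ := by
  refine le_of_forall_mem_Ioo_le_add_mul (c := c * ‖x - p‖ ^ 2) fun l hl => ?_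
  have hmin' := (hmin ((1 - l) • p + l • x)).trans
    (add_le_add_left (hRconvex p x (1 - l) l (by linarith [hl.2]) hl.1.le (by ring)) _)
  rw [← EReal.coe_toReal hp (hRbot p), ← EReal.coe_toReal hx (hRbot x)] at hmin'
  norm_cast at hmin'
  have hz : (1 - l) • p + l • x - v = (p - v) + l • (x - p) := by module
  rw [hz, norm_add_sq_real, norm_smul, inner_smul_right, mul_pow, Real.norm_eq_abs, sq_abs] at hmin'
  refine le_of_mul_le_mul_left ?_ hl.1
  nlinarith

theorem one_le_of_fista_recursion {t : ℕ → ℝ} (ht0 : t 0 = 1)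
    (htrec : ∀ k, t (k + 1) = (Real.sqrt (4 * t k ^ 2 + 1) + 1) / 2) (k : ℕ) : 1 ≤ t k := by
  cases k with
  | zero => exact ht0.ge
  | succ k =>
    have hsqrt : 1 ≤ Real.sqrt (4 * t k ^ 2 + 1) :=
      Real.one_le_sqrt.2 (by nlinarith [sq_nonneg (t k)])
    rw [htrec]
    linarith

theorem le_succ_of_fista_recursion {t : ℕ → ℝ}
    (htrec : ∀ k, t (k + 1) = (Real.sqrt (4 * t k ^ 2 + 1) + 1) / 2) (k : ℕ) : t k ≤ t (k + 1) := by
  have hsqrt : 2 * t k ≤ Real.sqrt (4 * t k ^ 2 + 1) := Real.le_sqrt_of_sq_le (by nlinarith)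
  rw [htrec]
  linarith

/-- One forward-backward step from an extrapolated point `s` with `‖s - x‖ ≤ α * ‖x - w‖`. -/
theorem forwardBackward_step_le {E : Type*} [NormedAddCommGroup E] [InnerProductSpace ℝ E]
    [CompleteSpace E] {D : E → ℝ} {gradD : E → E} (hdiff : ∀ x, HasGradientAt D (gradD x) x)
    {L : ℝ} (hL : 0 < L) (hLip : ∀ x y, ‖gradD x - gradD y‖ ≤ L * ‖x - y‖)
    {γ α rp rx : ℝ} (hγ0 : 0 < γ) (hγ : γ ≤ (1 - α ^ 2) / (2 * L)) {w x s p : E}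
    (hs : ‖s - x‖ ≤ α * ‖x - w‖)
    (hR : rp - rx ≤ 2 * (1 / (2 * γ)) * ⟪p - (s - γ • gradD s), x - p⟫) :
    D p + rp - (D x + rx) ≤ (1 / (2 * γ) - L) * (‖x - w‖ ^ 2 - ‖p - x‖ ^ 2)
      - (1 / (2 * γ) - L / 2) * ‖s - p‖ ^ 2 := by
  have hdescent := add_inner_gradient_sub_sq_le hdiff hLip p x
  have hcross : ⟪gradD s - gradD p, x - p⟫ ≤ L / 2 * (‖s - p‖ ^ 2 + ‖x - p‖ ^ 2) := by
    have hcs := real_inner_le_norm (gradD s - gradD p) (x - p)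
    have hlip := mul_le_mul_of_nonneg_right (hLip s p) (norm_nonneg (x - p))
    nlinarith [mul_nonneg hL.le (sq_nonneg (‖s - p‖ - ‖x - p‖))]
  have hprod : 2 * ⟪p - s, x - p⟫ = ‖s - x‖ ^ 2 - ‖s - p‖ ^ 2 - ‖x - p‖ ^ 2 := by
    have hpol := norm_add_sq_real (p - s) (x - p)
    rw [show p - s + (x - p) = x - s by abel, norm_sub_rev x s, norm_sub_rev p s] at hpol
    linarith
  have hinner : 2 * (1 / (2 * γ)) * ⟪p - (s - γ • gradD s), x - p⟫
      = 1 / (2 * γ) * (2 * ⟪p - s, x - p⟫) + ⟪gradD s, x - p⟫ := by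
    rw [show p - (s - γ • gradD s) = (p - s) + γ • gradD s by abel, inner_add_left,
      real_inner_smul_left]
    field_simp
  have hstep : 1 / (2 * γ) * α ^ 2 ≤ 1 / (2 * γ) - L := by
    rw [le_div_iff₀ (by positivity)] at hγ
    have hmul : 1 / (2 * γ) * (γ * (2 * L)) = L := by field_simp
    have hle := mul_le_mul_of_nonneg_left hγ (show 0 ≤ 1 / (2 * γ) by positivity)
    linarith
  have hextra : 1 / (2 * γ) * ‖s - x‖ ^ 2 ≤ (1 / (2 * γ) - L) * ‖x - w‖ ^ 2 := by
    have hsq : ‖s - x‖ ^ 2 ≤ α ^ 2 * ‖x - w‖ ^ 2 := by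
      rw [← mul_pow]
      gcongr
    have hle := mul_le_mul_of_nonneg_left hsq (show 0 ≤ 1 / (2 * γ) by positivity)
    nlinarith [mul_le_mul_of_nonneg_right hstep (sq_nonneg ‖x - w‖)]
  rw [hinner, hprod] at hR
  rw [inner_sub_left] at hcross
  rw [norm_sub_rev p x]
  linarith

/-- Per-iteration inequality of relaxed FISTA with step size `0 < γ ≤ (1 - α²)/(2L)`:
`F(f_{k+1}) - F(f_k) ≤ (1/(2γ) - L)(‖f_k - f_{k-1}‖² - ‖f_{k+1} - f_k‖²)
  - (1/(2γ) - L/2)‖s_{k+1} - f_{k+1}‖²` for all `k ≥ 0`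
(here `f_{-1} = f₀` is encoded by truncated subtraction `k - 1` on `ℕ`). -/
theorem stmt14 (N : ℕ)
    (D : EuclideanSpace ℝ (Fin N) → ℝ)
    (gradD : EuclideanSpace ℝ (Fin N) → EuclideanSpace ℝ (Fin N))
    (hdiff : ∀ x, HasGradientAt D (gradD x) x)
    (L : ℝ) (hL : 0 < L) (hLip : ∀ x y, ‖gradD x - gradD y‖ ≤ L * ‖x - y‖)
    (R : EuclideanSpace ℝ (Fin N) → EReal)
    (hRproper : ∃ x, R x ≠ ⊤) (hRbot : ∀ x, R x ≠ ⊥)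
    (hRconvex : ∀ x y : EuclideanSpace ℝ (Fin N), ∀ a b : ℝ, 0 ≤ a → 0 ≤ b → a + b = 1 →
      R (a • x + b • y) ≤ (a : EReal) * R x + (b : EReal) * R y)
    (hRlsc : LowerSemicontinuous R)
    (F : EuclideanSpace ℝ (Fin N) → EReal) (hF : ∀ x, F x = (D x : EReal) + R x)
    (γ α : ℝ) (hγ0 : 0 < γ) (hγ : γ ≤ (1 - α ^ 2) / (2 * L)) (hα0 : 0 ≤ α) (hα1 : α < 1)
    (prox : EuclideanSpace ℝ (Fin N) → EuclideanSpace ℝ (Fin N))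
    -- `prox x` is the unique minimizer of `z ↦ R(z) + (1/(2γ))‖z - x‖²`
    (hprox : ∀ x p, p = prox x ↔
      ∀ z, R p + ((1 / (2 * γ) * ‖p - x‖ ^ 2 : ℝ) : EReal) ≤
        R z + ((1 / (2 * γ) * ‖z - x‖ ^ 2 : ℝ) : EReal))
    (t : ℕ → ℝ) (ht0 : t 0 = 1)
    (htrec : ∀ k, t (k + 1) = (Real.sqrt (4 * t k ^ 2 + 1) + 1) / 2)
    (f s : ℕ → EuclideanSpace ℝ (Fin N))
    (hF0 : F (f 0) ≠ ⊤)
    (hs1 : s 1 = f 0)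
    (hfk : ∀ k, 1 ≤ k → f k = prox (s k - γ • gradD (s k)))
    (hsk : ∀ k, 1 ≤ k → s (k + 1) = f k + (α * ((t k - 1) / t (k + 1))) • (f k - f (k - 1))) :
    ∀ k : ℕ, F (f (k + 1)) - F (f k) ≤
      (((1 / (2 * γ) - L) * (‖f k - f (k - 1)‖ ^ 2 - ‖f (k + 1) - f k‖ ^ 2)
        - (1 / (2 * γ) - L / 2) * ‖s (k + 1) - f (k + 1)‖ ^ 2 : ℝ) : EReal) := by
  have hfin : ∀ k, R (f k) ≠ ⊤ := by
    intro k
    cases k with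
    | zero =>
      intro htop
      exact hF0 (by rw [hF, htop, EReal.coe_add_top])
    | succ k =>
      obtain ⟨z, hz⟩ := hRproper
      intro htop
      have hle := (hprox _ _).1 (hfk (k + 1) (Nat.le_add_left 1 k)) z
      rw [htop, EReal.top_add_coe, top_le_iff, ← EReal.coe_toReal hz (hRbot z)] at hle
      exact EReal.coe_ne_top _ hle
  have hextrapolate : ∀ k, ‖s (k + 1) - f k‖ ≤ α * ‖f k - f (k - 1)‖ := by
    intro k
    cases k with
    | zero => simp [hs1]
    | succ k =>
      have hone := one_le_of_fista_recursion ht0 htrec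
      have hpos : 0 < t (k + 1 + 1) := by linarith [hone (k + 1 + 1)]
      have hnonneg : 0 ≤ (t (k + 1) - 1) / t (k + 1 + 1) :=
        div_nonneg (by linarith [hone (k + 1)]) hpos.le
      have hle : (t (k + 1) - 1) / t (k + 1 + 1) ≤ 1 := by
        rw [div_le_one hpos]
        linarith [le_succ_of_fista_recursion htrec (k + 1)]
      rw [hsk (k + 1) (Nat.le_add_left 1 k), add_sub_cancel_left, norm_smul, Real.norm_eq_abs,
        abs_of_nonneg (mul_nonneg hα0 hnonneg)]
      gcongr
      exact mul_le_of_le_one_right hα0 hle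
  intro k
  have hR := toReal_sub_toReal_le_of_isMinimizer hRbot hRconvex (hfin (k + 1)) (hfin k)
    ((hprox _ _).1 (hfk (k + 1) (Nat.le_add_left 1 k)))
  have hstep := forwardBackward_step_le hdiff hL hLip hγ0 hγ (hextrapolate k) hR
  rw [hF, hF, ← EReal.coe_toReal (hfin (k + 1)) (hRbot _), ← EReal.coe_toReal (hfin k) (hRbot _)]
  exact_mod_cast hstep
end

section
/- (Summed gradient-mapping bound at the extrapolated points.) Under the relaxed FISTA setup with step size 0 < γ ≤ (1 − α²)/(2L) (so that γL < 1), and assuming F* := inf_{x∈ℝ^N} F(x) > −∞, for every K ≥ 1: Σ_{k=1}^{K} ‖G_γ(s_k)‖² ≤ 2L(F(f₀) − F*)/(γL(1 − γL)), where G_γ(x) = (x − prox_{γR}(x − γ∇D(x)))/γ. -/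
open scoped RealInnerProductSpace

section Smooth

variable {E : Type*} [NormedAddCommGroup E] [InnerProductSpace ℝ E] [CompleteSpace E]

/-- The descent lemma for a function with `L`-Lipschitz gradient. -/
theorem le_of_lipschitz_gradient {D : E → ℝ} {g : E → E} (hdiff : ∀ x, HasGradientAt D (g x) x)
    {L : ℝ} (hLip : ∀ x y, ‖g x - g y‖ ≤ L * ‖x - y‖) (x y : E) :
    D y ≤ D x + ⟪g x, y - x⟫ + L / 2 * ‖y - x‖ ^ 2 := by
  set v := y - x with hv
  let φ : ℝ → ℝ := fun τ => D (x + τ • v) - τ * ⟪g x, v⟫ - L / 2 * τ ^ 2 * ‖v‖ ^ 2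
  have hφ : ∀ τ, HasDerivAt φ (⟪g (x + τ • v), v⟫ - ⟪g x, v⟫ - L * τ * ‖v‖ ^ 2) τ := by
    intro τ
    have hline : HasDerivAt (fun τ : ℝ => x + τ • v) v τ := by
      simpa using ((hasDerivAt_id τ).smul_const v).const_add x
    have hD : HasDerivAt (fun τ : ℝ => D (x + τ • v)) ⟪g (x + τ • v), v⟫ τ := by
      simpa [Function.comp_def] using (hdiff (x + τ • v)).hasFDerivAt.comp_hasDerivAt τ hline
    have hlin : HasDerivAt (fun τ : ℝ => τ * ⟪g x, v⟫) ⟪g x, v⟫ τ := by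
      simpa using (hasDerivAt_id τ).mul_const ⟪g x, v⟫
    have hquad : HasDerivAt (fun τ : ℝ => L / 2 * τ ^ 2 * ‖v‖ ^ 2) (L * τ * ‖v‖ ^ 2) τ := by
      refine (((hasDerivAt_pow 2 τ).const_mul (L / 2)).mul_const (‖v‖ ^ 2)).congr_deriv ?_
      push_cast
      ring
    exact (hD.sub hlin).sub hquad
  have hanti : AntitoneOn φ (Set.Icc 0 1) := by
    refine antitoneOn_of_deriv_nonpos (convex_Icc 0 1)
      (fun τ _ => (hφ τ).continuousAt.continuousWithinAt)
      (fun τ _ => (hφ τ).differentiableAt.differentiableWithinAt) ?_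
    intro τ hτ
    rw [interior_Icc] at hτ
    rw [(hφ τ).deriv, ← inner_sub_left]
    have hg : ‖g (x + τ • v) - g x‖ ≤ L * (τ * ‖v‖) := by
      simpa [norm_smul, abs_of_pos hτ.1] using hLip (x + τ • v) x
    have hcs := real_inner_le_norm (g (x + τ • v) - g x) v
    nlinarith [mul_le_mul_of_nonneg_right hg (norm_nonneg v)]
  have h := hanti (Set.left_mem_Icc.2 zero_le_one) (Set.right_mem_Icc.2 zero_le_one) zero_le_one
  simp only [φ, zero_smul, one_smul, add_zero] at h
  rw [show x + v = y by simp [hv]] at h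
  linarith

/-- The lower quadratic bound for a function with `L`-Lipschitz gradient. -/
theorem ge_of_lipschitz_gradient {D : E → ℝ} {g : E → E} (hdiff : ∀ x, HasGradientAt D (g x) x)
    {L : ℝ} (hLip : ∀ x y, ‖g x - g y‖ ≤ L * ‖x - y‖) (x y : E) :
    D x + ⟪g x, y - x⟫ - L / 2 * ‖y - x‖ ^ 2 ≤ D y := by
  have hneg : ∀ x, HasGradientAt (fun z => -D z) (-g x) x := fun x => by
    rw [hasGradientAt_iff_hasFDerivAt, map_neg]
    exact (hdiff x).hasFDerivAt.neg
  have h := le_of_lipschitz_gradient hneg (L := L)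
    (fun x y => by rw [neg_sub_neg, norm_sub_rev]; exact hLip x y) x y
  rw [inner_neg_left] at h
  linarith

end Smooth

section Prox

variable {E : Type*} [NormedAddCommGroup E] [InnerProductSpace ℝ E]

/-- The variational inequality satisfied by a minimizer `p` of `z ↦ R z + (1/(2γ))‖z - x‖²`
for convex `R`. -/
theorem toReal_add_inner_le_of_isMin_prox {R : E → EReal} (hRbot : ∀ x, R x ≠ ⊥)
    (hRconvex : ∀ x y : E, ∀ a b : ℝ, 0 ≤ a → 0 ≤ b → a + b = 1 →
      R (a • x + b • y) ≤ (a : EReal) * R x + (b : EReal) * R y)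
    {γ : ℝ} {x p : E}
    (hp : ∀ z, R p + ((1 / (2 * γ) * ‖p - x‖ ^ 2 : ℝ) : EReal) ≤
      R z + ((1 / (2 * γ) * ‖z - x‖ ^ 2 : ℝ) : EReal))
    (hpTop : R p ≠ ⊤) {z : E} (hz : R z ≠ ⊤) :
    (R p).toReal + 1 / γ * ⟪z - p, x - p⟫ ≤ (R z).toReal := by
  set r := (R p).toReal
  set q := (R z).toReal
  have hRp : R p = (r : EReal) := (EReal.coe_toReal hpTop (hRbot p)).symm
  have hRz : R z = (q : EReal) := (EReal.coe_toReal hz (hRbot z)).symm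
  set B := 1 / (2 * γ) * ‖z - p‖ ^ 2 with hB
  have key : ∀ l : ℝ, 0 < l → l < 1 → r + 1 / γ * ⟪z - p, x - p⟫ ≤ q + l * B := by
    intro l hl hl1
    have h := (hp ((1 - l) • p + l • z)).trans
      (add_le_add_left (hRconvex p z (1 - l) l (by linarith) hl.le (by ring)) _)
    rw [hRp, hRz] at h
    have h' : r + 1 / (2 * γ) * ‖p - x‖ ^ 2 ≤
        (1 - l) * r + l * q + 1 / (2 * γ) * ‖(1 - l) • p + l • z - x‖ ^ 2 := by
      exact_mod_cast h
    have hexp : ‖(1 - l) • p + l • z - x‖ ^ 2 =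
        ‖p - x‖ ^ 2 - 2 * l * ⟪z - p, x - p⟫ + l ^ 2 * ‖z - p‖ ^ 2 := by
      rw [show (1 - l) • p + l • z - x = l • (z - p) - (x - p) by module, norm_sub_sq_real,
        inner_smul_left, norm_smul, norm_sub_rev x p, mul_pow, Real.norm_eq_abs, sq_abs]
      simp only [conj_trivial]
      ring
    have hγ : 1 / γ = 2 * (1 / (2 * γ)) := by ring
    rw [hexp] at h'
    rw [hγ]
    refine le_of_mul_le_mul_left ?_ hl
    rw [hB]
    linarith
  have hlim : Filter.Tendsto (fun l : ℝ => q + l * B) (nhdsWithin 0 (Set.Ioi 0)) (nhds q) := by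
    have : Continuous fun l : ℝ => q + l * B := by fun_prop
    simpa using (this.tendsto 0).mono_left nhdsWithin_le_nhds
  refine ge_of_tendsto hlim ?_
  filter_upwards [Ioo_mem_nhdsGT (zero_lt_one : (0 : ℝ) < 1)] with l hl using key l hl.1 hl.2

end Prox

/-- A minimizer of `z ↦ R z + c z`, with `c` finite, has finite `R`-value if `R` is proper. -/
theorem ne_top_of_isMin_add_coe {E : Type*} {R : E → EReal} {c : E → ℝ} {p z : E}
    (hp : R p + (c p : EReal) ≤ R z + (c z : EReal)) (hz : R z ≠ ⊤) : R p ≠ ⊤ := by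
  intro h
  rw [h, EReal.top_add_coe, top_le_iff] at hp
  exact (EReal.add_lt_top hz (EReal.coe_ne_top _)).ne hp

/-- The inertial parameters of FISTA lie in `[0, 1]`. -/
theorem fista_ratio_mem_Icc {t : ℕ → ℝ} (ht0 : t 0 = 1)
    (htrec : ∀ k, t (k + 1) = (Real.sqrt (4 * t k ^ 2 + 1) + 1) / 2) (k : ℕ) :
    (t k - 1) / t (k + 1) ∈ Set.Icc (0 : ℝ) 1 := by
  have hstep : ∀ k, t k ≤ t (k + 1) := fun k => by
    have : 2 * t k ≤ Real.sqrt (4 * t k ^ 2 + 1) := Real.le_sqrt_of_sq_le (by nlinarith)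
    rw [htrec]
    linarith
  have hone : ∀ k, 1 ≤ t k := fun k => ht0 ▸ monotone_nat_of_le_succ hstep (Nat.zero_le k)
  refine ⟨div_nonneg (by linarith [hone k]) (by linarith [hone (k + 1)]), ?_⟩
  rw [div_le_one (by linarith [hone (k + 1)])]
  linarith [hstep k]

/-- Summed gradient-mapping bound at the extrapolated points of relaxed FISTA with
step size `0 < γ ≤ (1 - α²)/(2L)` (so that `γL < 1`): if `F* = inf F > -∞`, then for
every `K ≥ 1`, `Σ_{k=1}^{K} ‖G_γ(s_k)‖² ≤ 2L(F(f₀) - F*)/(γL(1 - γL))`. -/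
theorem stmt16 (N : ℕ)
    (D : EuclideanSpace ℝ (Fin N) → ℝ)
    (gradD : EuclideanSpace ℝ (Fin N) → EuclideanSpace ℝ (Fin N))
    (hdiff : ∀ x, HasGradientAt D (gradD x) x)
    (L : ℝ) (hL : 0 < L) (hLip : ∀ x y, ‖gradD x - gradD y‖ ≤ L * ‖x - y‖)
    (R : EuclideanSpace ℝ (Fin N) → EReal)
    (hRproper : ∃ x, R x ≠ ⊤) (hRbot : ∀ x, R x ≠ ⊥)
    (hRconvex : ∀ x y : EuclideanSpace ℝ (Fin N), ∀ a b : ℝ, 0 ≤ a → 0 ≤ b → a + b = 1 →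
      R (a • x + b • y) ≤ (a : EReal) * R x + (b : EReal) * R y)
    (hRlsc : LowerSemicontinuous R)
    (F : EuclideanSpace ℝ (Fin N) → EReal) (hF : ∀ x, F x = (D x : EReal) + R x)
    (γ α : ℝ) (hγ0 : 0 < γ) (hγ : γ ≤ (1 - α ^ 2) / (2 * L)) (hα0 : 0 ≤ α) (hα1 : α < 1)
    (prox : EuclideanSpace ℝ (Fin N) → EuclideanSpace ℝ (Fin N))
    -- `prox x` is the unique minimizer of `z ↦ R(z) + (1/(2γ))‖z - x‖²`
    (hprox : ∀ x p, p = prox x ↔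
      ∀ z, R p + ((1 / (2 * γ) * ‖p - x‖ ^ 2 : ℝ) : EReal) ≤
        R z + ((1 / (2 * γ) * ‖z - x‖ ^ 2 : ℝ) : EReal))
    (t : ℕ → ℝ) (ht0 : t 0 = 1)
    (htrec : ∀ k, t (k + 1) = (Real.sqrt (4 * t k ^ 2 + 1) + 1) / 2)
    (f s : ℕ → EuclideanSpace ℝ (Fin N))
    (hF0 : F (f 0) ≠ ⊤)
    (hs1 : s 1 = f 0)
    (hfk : ∀ k, 1 ≤ k → f k = prox (s k - γ • gradD (s k)))
    (hsk : ∀ k, 1 ≤ k → s (k + 1) = f k + (α * ((t k - 1) / t (k + 1))) • (f k - f (k - 1)))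
    (Fstar : EReal) (hFstar : Fstar = ⨅ x, F x) (hFstarBot : ⊥ < Fstar) :
    ∀ K : ℕ, 1 ≤ K →
      ∑ k ∈ Finset.Icc 1 K, ‖gradMap γ gradD prox (s k)‖ ^ 2 ≤
        2 * L * (F (f 0) - Fstar).toReal / (γ * L * (1 - γ * L)) := by
  have hγL : 2 * (γ * L) ≤ 1 - α ^ 2 := by
    rw [le_div_iff₀ (by positivity)] at hγ
    linarith
  have hγL0 : 0 < γ * L := mul_pos hγ0 hL
  have hγL1 : 0 < 1 - γ * L := by nlinarith [sq_nonneg α]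
  have hmin : ∀ k, 1 ≤ k → ∀ z,
      R (f k) + ((1 / (2 * γ) * ‖f k - (s k - γ • gradD (s k))‖ ^ 2 : ℝ) : EReal) ≤
        R z + ((1 / (2 * γ) * ‖z - (s k - γ • gradD (s k))‖ ^ 2 : ℝ) : EReal) :=
    fun k hk => (hprox _ _).1 (hfk k hk)
  have hR0 : R (f 0) ≠ ⊤ := fun h => hF0 (by rw [hF, h, EReal.coe_add_top])
  have hRtop : ∀ k, R (f k) ≠ ⊤ := fun k => by
    rcases Nat.eq_zero_or_pos k with rfl | hk
    · exact hR0
    · exact ne_top_of_isMin_add_coe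
        (c := fun z => 1 / (2 * γ) * ‖z - (s k - γ • gradD (s k))‖ ^ 2) (hmin k hk (f 0)) hR0
  set Φ : ℕ → ℝ := fun k => D (f k) + (R (f k)).toReal with hΦ
  have hFΦ : ∀ k, F (f k) = (Φ k : EReal) := fun k => by
    rw [hF, hΦ, EReal.coe_add, EReal.coe_toReal (hRtop k) (hRbot _)]
  have hdescent : ∀ k, Φ (k + 1) + (1 - γ * L) / (2 * γ) * ‖s (k + 1) - f (k + 1)‖ ^ 2 +
      1 / (2 * γ) * ‖f (k + 1) - f k‖ ^ 2 ≤
        Φ k + (1 + γ * L) / (2 * γ) * ‖s (k + 1) - f k‖ ^ 2 := by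
    intro k
    have hupper := le_of_lipschitz_gradient hdiff hLip (s (k + 1)) (f (k + 1))
    have hlower := ge_of_lipschitz_gradient hdiff hLip (s (k + 1)) (f k)
    have hvar := toReal_add_inner_le_of_isMin_prox hRbot hRconvex
      (hmin (k + 1) (Nat.le_add_left 1 k)) (hRtop (k + 1)) (hRtop k)
    set u := s (k + 1) - f (k + 1) with hu
    set w := s (k + 1) - f k with hw
    set g := gradD (s (k + 1))
    rw [show f (k + 1) - s (k + 1) = -u by simp [hu], inner_neg_right, norm_neg] at hupper
    rw [show f k - s (k + 1) = -w by simp [hw], inner_neg_right, norm_neg] at hlower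
    rw [show f k - f (k + 1) = u - w by simp [hu, hw],
      show s (k + 1) - γ • g - f (k + 1) = u - γ • g by simp only [hu]; abel,
      inner_sub_right, inner_smul_right, inner_sub_left u w u, inner_sub_left u w g,
      real_inner_self_eq_norm_sq, mul_sub,
      ← mul_assoc (1 / γ) γ, one_div_mul_cancel hγ0.ne', one_mul] at hvar
    rw [show f (k + 1) - f k = w - u by simp [hu, hw], norm_sub_sq_real w u]
    have hc1 : (1 - γ * L) / (2 * γ) = 1 / γ / 2 - L / 2 := by field_simp
    have hc2 : (1 + γ * L) / (2 * γ) = 1 / γ / 2 + L / 2 := by field_simp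
    have hc3 : 1 / (2 * γ) = 1 / γ / 2 := by field_simp
    rw [hc1, hc2, hc3]
    simp only [hΦ]
    rw [real_inner_comm] at hupper hlower
    linarith
  have hinertia : ∀ k, 1 ≤ k → (1 + γ * L) / (2 * γ) * ‖s (k + 1) - f k‖ ^ 2 ≤
      1 / (2 * γ) * ‖f k - f (k - 1)‖ ^ 2 := by
    intro k hk
    obtain ⟨hθ0, hθ1⟩ := fista_ratio_mem_Icc ht0 htrec k
    rw [hsk k hk, add_sub_cancel_left, norm_smul, mul_pow, Real.norm_eq_abs, sq_abs, mul_pow,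
      ← mul_assoc]
    gcongr
    have hθ : ((t k - 1) / t (k + 1)) ^ 2 ≤ 1 := pow_le_one₀ hθ0 hθ1
    have hα2 : α ^ 2 ≤ 1 := pow_le_one₀ hα0 hα1.le
    have hcoef : (1 + γ * L) * α ^ 2 ≤ 1 := by nlinarith [sq_nonneg α]
    rw [div_mul_eq_mul_div, ← mul_assoc]
    gcongr
    exact mul_le_one₀ hcoef (sq_nonneg _) hθ
  have hsum : ∀ K, 1 ≤ K → (1 - γ * L) / (2 * γ) * ∑ k ∈ Finset.Icc 1 K, ‖s k - f k‖ ^ 2 +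
      Φ K + 1 / (2 * γ) * ‖f K - f (K - 1)‖ ^ 2 ≤ Φ 0 := by
    intro K hK
    induction K, hK using Nat.le_induction with
    | base =>
      have h := hdescent 0
      simp only [zero_add, hs1, sub_self, norm_zero] at h
      simp only [Finset.Icc_self, Finset.sum_singleton, hs1, Nat.sub_self]
      linarith
    | succ K hK ih =>
      rw [Finset.sum_Icc_succ_top (by omega), mul_add, Nat.add_sub_cancel]
      linarith [hdescent K, hinertia K hK]
  have hle : ∀ k, Fstar ≤ (Φ k : EReal) := fun k => by
    rw [← hFΦ, hFstar]
    exact iInf_le _ _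
  obtain ⟨m, hm⟩ : ∃ m : ℝ, Fstar = (m : EReal) :=
    ⟨Fstar.toReal, (EReal.coe_toReal ((hle 0).trans_lt (EReal.coe_lt_top _)).ne hFstarBot.ne').symm⟩
  intro K hK
  have hmK : m ≤ Φ K := by
    have := hle K
    rw [hm] at this
    exact_mod_cast this
  have hgrad : ∑ k ∈ Finset.Icc 1 K, ‖gradMap γ gradD prox (s k)‖ ^ 2 =
      (γ ^ 2)⁻¹ * ∑ k ∈ Finset.Icc 1 K, ‖s k - f k‖ ^ 2 := by
    rw [Finset.mul_sum]
    refine Finset.sum_congr rfl fun k hk => ?_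
    rw [gradMap, ← hfk k (Finset.mem_Icc.1 hk).1, norm_smul, mul_pow, Real.norm_eq_abs, sq_abs,
      inv_pow]
  rw [hgrad, hFΦ, hm, ← EReal.coe_sub, EReal.toReal_coe, le_div_iff₀ (mul_pos hγL0 hγL1)]
  have hbound : (1 - γ * L) / (2 * γ) * ∑ k ∈ Finset.Icc 1 K, ‖s k - f k‖ ^ 2 ≤ Φ 0 - m := by
    have : 0 ≤ 1 / (2 * γ) * ‖f K - f (K - 1)‖ ^ 2 := by positivity
    linarith [hsum K hK]
  calc (γ ^ 2)⁻¹ * (∑ k ∈ Finset.Icc 1 K, ‖s k - f k‖ ^ 2) * (γ * L * (1 - γ * L))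
      = 2 * L * ((1 - γ * L) / (2 * γ) * ∑ k ∈ Finset.Icc 1 K, ‖s k - f k‖ ^ 2) := by
        field_simp
    _ ≤ 2 * L * (Φ 0 - m) := by gcongr
end
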